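/- Stability of the tensor product decomposition for general linear groups, in character form: let λ and μ be partitions and let r ≥ l(λ) + l(μ). Then there exists a finitely supported family of natural numbers c_ν, indexed by partitions ν, with c_ν = 0 whenever l(ν) > l(λ) + l(μ), such that simultaneously S_λ^{(r)} · S_μ^{(r)} = Σ_ν c_ν S_ν^{(r)} holds in ℤ[X_1,…,X_r] and S_λ^{(r+1)} · S_μ^{(r+1)} = Σ_ν c_ν S_ν^{(r+1)} holds in ℤ[X_1,…,X_{r+1}] (i.e., the structure constants of the product of the irreducible characters of GL are the same for r and for r+1 variables). -/

import Mathlib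

open MvPolynomial

/-- A partition: a weakly decreasing sequence of nonnegative integers with
finitely many nonzero terms. `parts i` is the `(i+1)`-st part `λ_{i+1}`
(0-indexed). -/
structure Partition' where
  parts : ℕ → ℕ
  antitone : Antitone parts
  eventually_zero : ∃ N, parts N = 0

namespace Partition'

/-- The length `l(λ)`: the number of nonzero parts, i.e. the least index
at which the (weakly decreasing) sequence of parts vanishes. -/
noncomputable def length (lam : Partition') : ℕ := sInf {n | lam.parts n = 0}

/-- The size `|λ| = Σᵢ λᵢ`. -/
noncomputable def size (lam : Partition') : ℕ := ∑ᶠ i, lam.parts i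

/-- The partition `(μ_1, …, μ_{r-1})` obtained from `μ` by deleting all parts
from the `r`-th one on. -/
def drop (mu : Partition') (r : ℕ) : Partition' where
  parts i := if i + 1 < r then mu.parts i else 0
  antitone := by
    intro i j hij
    dsimp only
    split_ifs with h1 h2
    · exact mu.antitone hij
    · omega
    · exact Nat.zero_le _
    · exact le_refl 0
  eventually_zero := ⟨r, if_neg (by omega)⟩

end Partition'

/-- `IsHorizontalStrip mu xi` says that the skew shape `μ/ξ` is a horizontal
strip: `μ_i ≥ ξ_i ≥ μ_{i+1}` for all `i ≥ 1`. -/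
def IsHorizontalStrip (mu xi : Partition') : Prop :=
  ∀ i, xi.parts i ≤ mu.parts i ∧ mu.parts (i + 1) ≤ xi.parts i

/-- The size `|μ/ξ| = |μ| - |ξ|` of a skew shape, computed as the sum of
the pointwise differences of the parts. -/
noncomputable def stripSize (mu xi : Partition') : ℕ := ∑ᶠ i, (mu.parts i - xi.parts i)

/-- The complete homogeneous symmetric polynomial `h_d` in `m` variables over `ℤ`,
extended by `h_d = 0` for `d < 0` (and `h_0 = 1`). -/
noncomputable def hpoly (m : ℕ) (d : ℤ) : MvPolynomial (Fin m) ℤ :=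
  if 0 ≤ d then MvPolynomial.hsymm (Fin m) ℤ d.toNat else 0

/-- The Schur polynomial `S_λ^{(m)} ∈ ℤ[X_1,…,X_m]`, defined by the Jacobi–Trudi
formula `S_λ^{(m)} = det (h_{λ_i - i + j})_{1 ≤ i,j ≤ N}` with `N = l(λ)`. -/
noncomputable def schur (m : ℕ) (lam : Partition') : MvPolynomial (Fin m) ℤ :=
  Matrix.det (Matrix.of fun i j : Fin lam.length =>
    hpoly m ((lam.parts i : ℤ) - (i : ℤ) + (j : ℤ)))

/-- The ring homomorphism `p_n : ℤ[X_1,…,X_{n+1}] → ℤ[X_1,…,X_n]` determined by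
`X_i ↦ X_i` for `i ≤ n` and `X_{n+1} ↦ 0`. -/
noncomputable def pmap (n : ℕ) : MvPolynomial (Fin (n + 1)) ℤ →ₐ[ℤ] MvPolynomial (Fin n) ℤ :=
  aeval (fun i : Fin (n + 1) => if h : (i : ℕ) < n then X (⟨i, h⟩ : Fin n) else 0)

/-! ### Generic Jacobi–Trudi determinants and the Pieri rule -/

/-- Jacobi–Trudi determinant of size `n` for an abstract sequence `h`. -/
noncomputable def Sd {R : Type} [CommRing R] (h : ℤ → R) (n : ℕ) (a : ℕ → ℤ) : R :=
  Matrix.det (Matrix.of fun i j : Fin n => h (a i - (i : ℤ) + (j : ℤ)))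

theorem det_last_row {R : Type} [CommRing R] {n : ℕ} (A : Matrix (Fin (n+1)) (Fin (n+1)) R)
    (hA : ∀ j : Fin n, A (Fin.last n) j.castSucc = 0) :
    A.det = A (Fin.last n) (Fin.last n) * (A.submatrix Fin.castSucc Fin.castSucc).det := by
  rw [Matrix.det_succ_row A (Fin.last n), Fin.sum_univ_castSucc]
  simp only [hA, mul_zero, zero_mul, Finset.sum_const_zero, zero_add]
  have : (-1 : R) ^ (((Fin.last n : Fin (n+1)) : ℕ) + ((Fin.last n : Fin (n+1)) : ℕ)) = 1 :=
    Even.neg_one_pow ⟨_, rfl⟩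
  rw [this, one_mul]
  congr 3
  · ext i; simp
  · ext i; simp

theorem Sd_succ {R : Type} [CommRing R] (h : ℤ → R) (h0 : h 0 = 1) (hn : ∀ d < 0, h d = 0)
    (n : ℕ) (a : ℕ → ℤ) (ha : a n = 0) : Sd h (n+1) a = Sd h n a := by
  unfold Sd
  rw [det_last_row]
  · simp only [Matrix.of_apply, Fin.val_last, ha]
    rw [show (0 : ℤ) - n + n = 0 by ring, h0, one_mul]
    congr 1
  · intro j
    simp only [Matrix.of_apply, Fin.val_last, ha, Fin.val_castSucc]
    apply hn
    have := j.2
    omega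

theorem Sd_stable {R : Type} [CommRing R] (h : ℤ → R) (h0 : h 0 = 1) (hn : ∀ d < 0, h d = 0)
    (L n : ℕ) (hLn : L ≤ n) (a : ℕ → ℤ) (ha : ∀ i, L ≤ i → a i = 0) : Sd h n a = Sd h L a := by
  induction n, hLn using Nat.le_induction with
  | base => rfl
  | succ n hn' ih => rw [Sd_succ h h0 hn n a (ha n hn'), ih]

/-- Horizontal strip relation. -/
def Strip (a b : ℕ → ℤ) : Prop := ∀ i, a i ≤ b i ∧ b (i+1) ≤ a i

/-- Generating series `∑ h (c + m) z ^ m`. -/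
noncomputable def Gs {R : Type} [CommRing R] (h : ℤ → R) (c : ℤ) : PowerSeries R :=
  PowerSeries.mk fun m => h (c + m)

theorem Gs_rec {R : Type} [CommRing R] (h : ℤ → R) (c : ℤ) :
    Gs h c = PowerSeries.C (h c) + PowerSeries.X * Gs h (c+1) := by
  ext m
  cases m with
  | zero => simp [Gs]
  | succ m =>
    simp only [Gs, map_add, PowerSeries.coeff_mk, PowerSeries.coeff_succ_X_mul,
      PowerSeries.coeff_C, Nat.succ_ne_zero, if_false, zero_add]
    congr 1; push_cast; ring

theorem det_Gs {R : Type} [CommRing R] (h : ℤ → R) (hn : ∀ d < 0, h d = 0)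
    (n : ℕ) (a : ℕ → ℤ) (ha : a n = 0) :
    Matrix.det (Matrix.of fun i j : Fin (n+1) => Gs h (a i - (i : ℤ) + (j : ℤ)))
      = Gs h 0 * PowerSeries.C (Sd h n a) := by
  let B : Matrix (Fin (n+1)) (Fin (n+1)) (PowerSeries R) := Matrix.of fun i j =>
    if j = Fin.last n then Gs h (a i - (i : ℤ) + (j : ℤ))
    else PowerSeries.C (h (a i - (i : ℤ) + (j : ℤ)))
  have h1 : Matrix.det (Matrix.of fun i j : Fin (n+1) => Gs h (a i - (i : ℤ) + (j : ℤ)))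
      = B.det := by
    rw [← Matrix.det_submatrix_equiv_self Fin.revPerm, ← Matrix.det_submatrix_equiv_self Fin.revPerm B]
    apply Matrix.det_eq_of_forall_col_eq_smul_add_pred (fun _ => PowerSeries.X)
    · intro i
      simp [B]
    · intro i j
      have hj : Fin.rev j.succ ≠ Fin.last n := by
        intro hh
        have := congrArg Fin.val hh
        simp [Fin.val_rev] at this
        have := j.2
        omega
      simp only [B, Matrix.submatrix_apply, Matrix.of_apply, Fin.revPerm_apply, if_neg hj]
      rw [Gs_rec]
      congr 3
      simp only [Fin.val_rev, Fin.val_succ, Fin.val_castSucc]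
      have := j.2
      omega
  rw [h1, det_last_row]
  · congr 1
    · simp [B, ha]
    · unfold Sd
      rw [RingHom.map_det]
      congr 1
      ext i j : 2
      have hj : j.castSucc ≠ Fin.last n := (Fin.castSucc_lt_last j).ne
      simp [B, hj]
  · intro j
    have hj : j.castSucc ≠ Fin.last n := (Fin.castSucc_lt_last j).ne
    simp only [B, Matrix.of_apply, if_neg hj, Fin.val_last, ha, Fin.val_castSucc]
    rw [hn, map_zero]
    have := j.2
    omega

/-- interlacing condition at row `i` for the increment `m`. -/
def okRow (a : ℕ → ℤ) (i m : ℕ) : Prop := i = 0 ∨ a i + m ≤ a (i-1)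

open Classical in
theorem det_trunc {R : Type} [CommRing R] (h : ℤ → R) 
    (n : ℕ) (a : ℕ → ℤ) (hanti : Antitone a) :
    Matrix.det (Matrix.of fun i j : Fin (n+1) => Gs h (a i - (i : ℤ) + (j : ℤ))) =
    Matrix.det (Matrix.of fun i j : Fin (n+1) => (PowerSeries.mk fun m =>
      if okRow a i m then h (a i - (i : ℤ) + (j : ℤ) + m) else 0 : PowerSeries R)) := by
  apply Matrix.det_eq_of_forall_row_eq_smul_add_pred
    (fun i : Fin n => PowerSeries.X ^ (a i + 1 - a (i+1)).toNat)
  · intro j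
    ext m
    simp [Gs, okRow]
  · intro i j
    ext m
    have hi := hanti (Nat.le_succ (i : ℕ))
    simp only [Nat.succ_eq_add_one] at hi
    simp only [Matrix.of_apply, map_add, PowerSeries.coeff_mk, Gs, PowerSeries.coeff_X_pow_mul',
      okRow, Fin.val_succ, Fin.val_castSucc, Nat.add_sub_cancel, Nat.succ_ne_zero, false_or]
    by_cases hm : a (↑i+1) + (m:ℤ) ≤ a i
    · rw [if_pos hm, if_neg (by omega), add_zero]
    · rw [if_neg hm, if_pos (by omega), zero_add]
      congr 1
      push_cast
      omega

open Classical in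
theorem pieri_coeff {R : Type} [CommRing R] (h : ℤ → R) (hn : ∀ d < 0, h d = 0)
    (n : ℕ) (a : ℕ → ℤ) (hanti : Antitone a) (ha : a n = 0) (k : ℕ) :
    h k * Sd h n a = ∑ l ∈ (Finset.finsuppAntidiag (Finset.univ : Finset (Fin (n+1))) k).filter
        (fun l => ∀ i : Fin (n+1), okRow a i (l i)),
      Matrix.det (Matrix.of fun i j : Fin (n+1) => h (a i + l i - (i : ℤ) + (j : ℤ))) := by
  have h1 := (det_trunc h n a hanti).symm.trans (det_Gs h hn n a ha)
  have h2 := congrArg (PowerSeries.coeff k) h1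
  rw [PowerSeries.coeff_mul_C] at h2
  simp only [Gs, PowerSeries.coeff_mk, zero_add] at h2
  rw [← h2, ← Matrix.det_transpose, Matrix.det_apply, map_sum]
  simp only [Units.smul_def, map_zsmul, PowerSeries.coeff_prod, Matrix.transpose_apply,
    Matrix.of_apply, PowerSeries.coeff_mk, Finset.smul_sum]
  rw [Finset.sum_comm, Finset.sum_filter]
  apply Finset.sum_congr rfl
  intro l _
  split_ifs with hl
  · rw [← Matrix.det_transpose, Matrix.det_apply]
    apply Finset.sum_congr rfl
    intro σ _
    simp only [Units.smul_def]
    congr 1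
    apply Finset.prod_congr rfl
    intro i _
    rw [if_pos (hl i)]
    simp only [Matrix.transpose_apply, Matrix.of_apply]
    congr 1
    ring
  · push Not at hl
    obtain ⟨i, hi⟩ := hl
    apply Finset.sum_eq_zero
    intro σ _
    rw [Finset.prod_eq_zero (Finset.mem_univ i) (if_neg hi), smul_zero]

theorem pieri (n : ℕ) (a : ℕ → ℤ) (hanti : Antitone a) (ha : ∀ i, n ≤ i → a i = 0) (k : ℤ) :
    ∃ F : Finset (ℕ → ℤ),
      (∀ b, b ∈ F ↔ Strip a b ∧ ∑ i ∈ Finset.range (n+1), (b i - a i) = k) ∧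
      ∀ (R : Type) [CommRing R] (h : ℤ → R), h 0 = 1 → (∀ d < 0, h d = 0) →
        Sd h (n+1) a * h k = ∑ b ∈ F, Sd h (n+1) b := by
  classical
  by_cases hk : k < 0
  · refine ⟨∅, ?_, ?_⟩
    · intro b
      simp only [Finset.notMem_empty, false_iff, not_and]
      intro hs hsum
      have : 0 ≤ ∑ i ∈ Finset.range (n+1), (b i - a i) :=
        Finset.sum_nonneg fun i _ => by linarith [(hs i).1]
      omega
    · intro R _ h h0 hn
      simp [hn k hk]
  obtain ⟨k, rfl⟩ := Int.eq_ofNat_of_zero_le (not_lt.mp hk)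
  let φ : (Fin (n+1) →₀ ℕ) → ℕ → ℤ := fun l i =>
    a i + if hi : i < n+1 then (l ⟨i, hi⟩ : ℤ) else 0
  have φv : ∀ l (i : Fin (n+1)), φ l i = a i + l i := by
    intro l i
    simp only [φ, dif_pos i.2]
  have φinj : Function.Injective φ := by
    intro l l' hll
    ext i
    have := congrFun hll (i : ℕ)
    rw [φv, φv] at this
    omega
  refine ⟨((Finset.finsuppAntidiag (Finset.univ : Finset (Fin (n+1))) k).filter
        (fun l => ∀ i : Fin (n+1), okRow a i (l i))).image φ, ?_, ?_⟩
  · intro b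
    simp only [Finset.mem_image, Finset.mem_filter, Finset.mem_finsuppAntidiag]
    constructor
    · rintro ⟨l, ⟨⟨hl, -⟩, hok⟩, rfl⟩
      refine ⟨?_, ?_⟩
      · intro i
        constructor
        · simp only [φ]; split_ifs <;> omega
        · by_cases hi : i + 1 < n + 1
          · have := hok ⟨i+1, hi⟩
            simp only [okRow, Nat.succ_ne_zero, false_or, Nat.add_sub_cancel] at this
            simp only [φ, dif_pos hi]
            exact this
          · simp only [φ, dif_neg hi]
            have := hanti (Nat.le_succ i)
            simpa using this
      · rw [Finset.sum_range, ← hl]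
        push_cast
        apply Finset.sum_congr rfl
        intro i _
        rw [φv]; ring
    · rintro ⟨hs, hsum⟩
      refine ⟨Finsupp.equivFunOnFinite.symm (fun i : Fin (n+1) => (b i - a i).toNat), ⟨⟨?_, ?_⟩, ?_⟩, ?_⟩
      · simp only [Finsupp.equivFunOnFinite_symm_apply_apply]
        zify
        rw [Finset.sum_range] at hsum
        rw [← hsum]
        apply Finset.sum_congr rfl
        intro i _
        have := (hs i).1
        omega
      · simp
      · intro i
        simp only [Finsupp.equivFunOnFinite_symm_apply_apply, okRow]
        have h1 := (hs i).1
        rcases Nat.eq_zero_or_pos (i : ℕ) with h | h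
        · exact Or.inl h
        · right
          have h2 := (hs (i-1)).2
          rw [Nat.sub_add_cancel h] at h2
          omega
      · ext i
        simp only [φ, Finsupp.equivFunOnFinite_symm_apply_apply]
        have h1 := (hs i).1
        split_ifs with hi
        · omega
        · have h2 := (hs (i-1)).2
          rw [Nat.sub_add_cancel (by omega)] at h2
          rw [ha (i-1) (by omega)] at h2
          rw [ha i (by omega)] at *
          omega
  · intro R _ h h0 hn
    rw [Finset.sum_image (fun _ _ _ _ hh => φinj hh), Sd_succ h h0 hn n a (ha n le_rfl), mul_comm,
      pieri_coeff h hn n a hanti (ha n le_rfl) k]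
    apply Finset.sum_congr rfl
    intro l _
    unfold Sd
    simp only [φv]

/-! ### Chains of horizontal strips -/

theorem Strip.antitone {a b : ℕ → ℤ} (hs : Strip a b) : Antitone b :=
  antitone_nat_of_succ_le fun i => (hs i).2.trans (hs i).1

/-- Chains `μ = ν 0 ⊆ ν 1 ⊆ ⋯ ⊆ ν N` of horizontal strips with content `α`. -/
def Chain (μ : ℕ → ℤ) (n N : ℕ) (α : ℕ → ℤ) (ν : ℕ → ℕ → ℤ) : Prop :=
  ν 0 = μ ∧ (∀ t < N, Strip (ν t) (ν (t+1))) ∧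
    (∀ t < N, ∑ i ∈ Finset.range n, (ν (t+1) i - ν t i) = α t) ∧ ∀ t, N ≤ t → ν t = ν N

theorem chain_facts {μ : ℕ → ℤ} {n N : ℕ} {α : ℕ → ℤ} {ν : ℕ → ℕ → ℤ} (hc : Chain μ n N α ν)
    (hanti : Antitone μ) (L : ℕ) (hL : ∀ i, L ≤ i → μ i = 0) (t : ℕ) (ht : t ≤ N) :
    Antitone (ν t) ∧ ∀ i, L + t ≤ i → ν t i = 0 := by
  induction t with
  | zero => rw [hc.1]; exact ⟨hanti, hL⟩
  | succ t ih =>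
    obtain ⟨h1, h2⟩ := ih (by omega)
    have hs := hc.2.1 t (by omega)
    refine ⟨hs.antitone, ?_⟩
    intro i hi
    have h3 := (hs (i-1)).2
    have h4 := (hs i).1
    rw [Nat.sub_add_cancel (by omega), h2 _ (by omega)] at h3
    rw [h2 _ (by omega)] at h4
    omega

theorem chain_sum (μ : ℕ → ℤ) (hanti : Antitone μ) (L : ℕ) (hL : ∀ i, L ≤ i → μ i = 0)
    (n : ℕ) (α : ℕ → ℤ) (N : ℕ) (hN : L + N ≤ n) :
    ∃ C : Finset (ℕ → ℕ → ℤ), (∀ ν, ν ∈ C ↔ Chain μ n N α ν) ∧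
      ∀ (R : Type) [CommRing R] (h : ℤ → R), h 0 = 1 → (∀ d < 0, h d = 0) →
        Sd h n μ * ∏ t ∈ Finset.range N, h (α t) = ∑ ν ∈ C, Sd h n (ν N) := by
  classical
  induction N with
  | zero =>
    refine ⟨{fun _ => μ}, ?_, ?_⟩
    · intro ν
      simp only [Finset.mem_singleton, Chain]
      constructor
      · rintro rfl; simp
      · rintro ⟨h1, -, -, h2⟩
        ext t : 1
        rw [h2 t (by omega), h1]
    · intro R _ h h0 hn
      simp
  | succ N ih =>
    obtain ⟨C, hC, hsum⟩ := ih (by omega)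
    obtain ⟨m, rfl⟩ : ∃ m, n = m + 1 := ⟨n - 1, by omega⟩
    have key : ∀ a : ℕ → ℤ, ∃ F : Finset (ℕ → ℤ), (Antitone a → (∀ i, m ≤ i → a i = 0) →
      ((∀ b, b ∈ F ↔ Strip a b ∧ ∑ i ∈ Finset.range (m+1), (b i - a i) = α N) ∧
      ∀ (R : Type) [CommRing R] (h : ℤ → R), h 0 = 1 → (∀ d < 0, h d = 0) →
        Sd h (m+1) a * h (α N) = ∑ b ∈ F, Sd h (m+1) b)) := by
      intro a
      by_cases h1 : Antitone a ∧ ∀ i, m ≤ i → a i = 0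
      · obtain ⟨F, hF⟩ := pieri m a h1.1 h1.2 (α N)
        exact ⟨F, fun _ _ => hF⟩
      · exact ⟨∅, fun h2 h3 => absurd ⟨h2, h3⟩ h1⟩
    choose F hF using key
    have hFC : ∀ ν ∈ C, _ := fun ν hν => by
      have h1 := chain_facts ((hC ν).1 hν) hanti L hL N le_rfl
      exact hF (ν N) h1.1 (fun i hi => h1.2 i (by omega))
    let ext1 : (ℕ → ℕ → ℤ) → (ℕ → ℤ) → ℕ → ℕ → ℤ := fun ν b t => if t ≤ N then ν t else b
    refine ⟨(C.sigma fun ν => F (ν N)).image (fun p => ext1 p.1 p.2), ?_, ?_⟩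
    · intro ν
      simp only [Finset.mem_image, Finset.mem_sigma]
      constructor
      · rintro ⟨⟨κ, b⟩, ⟨hκ, hb⟩, rfl⟩
        dsimp only at hκ hb ⊢
        obtain ⟨c1, c2, c3, c4⟩ := (hC κ).1 hκ
        obtain ⟨d1, d2⟩ := ((hFC κ hκ).1 b).1 hb
        refine ⟨by simp [ext1, c1], ?_, ?_, ?_⟩
        · intro t ht
          rcases Nat.lt_succ_iff_lt_or_eq.1 ht with h | rfl
          · simp only [ext1, if_pos h.le, if_pos (Nat.succ_le_of_lt h)]
            exact c2 t h
          · simpa [ext1] using d1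
        · intro t ht
          rcases Nat.lt_succ_iff_lt_or_eq.1 ht with h | rfl
          · simp only [ext1, if_pos h.le, if_pos (Nat.succ_le_of_lt h)]
            exact c3 t h
          · simpa [ext1] using d2
        · intro t ht
          simp only [ext1]
          rw [if_neg (by omega), if_neg (by omega)]
      · rintro ⟨c1, c2, c3, c4⟩
        have hm : (fun t => if t ≤ N then ν t else ν N) ∈ C := by
          rw [hC]
          refine ⟨by simp [c1], ?_, ?_, ?_⟩
          · intro t ht
            simp only [if_pos ht.le, if_pos (Nat.succ_le_of_lt ht)]
            exact c2 t (by omega)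
          · intro t ht
            simp only [if_pos ht.le, if_pos (Nat.succ_le_of_lt ht)]
            exact c3 t (by omega)
          · intro t ht
            simp only [le_refl, if_true]
            split_ifs with h
            · rw [le_antisymm h ht]
            · rfl
        refine ⟨⟨fun t => if t ≤ N then ν t else ν N, ν (N+1)⟩, ⟨hm, ?_⟩, ?_⟩
        · refine ((hFC _ hm).1 _).2 ?_
          simp only [le_refl, if_true]
          exact ⟨c2 N (by omega), c3 N (by omega)⟩
        · ext t : 1
          simp only [ext1]
          split_ifs with h
          · rfl
          · exact (c4 t (by omega)).symm
    · intro R _ h h0 hn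
      rw [Finset.sum_image, Finset.sum_sigma, Finset.prod_range_succ, ← mul_assoc,
        hsum R h h0 hn, Finset.sum_mul]
      · apply Finset.sum_congr rfl
        intro ν hν
        rw [(hFC ν hν).2 R h h0 hn]
        apply Finset.sum_congr rfl
        intro b _
        simp [ext1]
      · rintro ⟨κ, b⟩ hp ⟨κ', b'⟩ hp' heq
        simp only [Finset.coe_sigma, Set.mem_sigma_iff, Finset.mem_coe] at hp hp'
        dsimp only at heq
        have e1 : κ = κ' := by
          have : ∀ t ≤ N, κ t = κ' t := by
            intro t ht
            have := congrFun heq t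
            simpa [ext1, ht] using this
          ext t : 1
          by_cases ht : t ≤ N
          · exact this t ht
          · rw [((hC κ).1 hp.1).2.2.2 t (by omega), ((hC κ').1 hp'.1).2.2.2 t (by omega),
              this N le_rfl]
        have e2 : b = b' := by
          have := congrFun heq (N+1)
          simpa [ext1] using this
        rw [e1, e2]

/-! ### The sign-reversing involution -/

/-- Excess of `k+1`'s over `k`'s (lattice word condition at row `i`). -/
def exc (x y z : ℕ → ℤ) (i : ℕ) : ℤ :=
  ∑ j ∈ Finset.range (i+1), (z j - y j) - ∑ j ∈ Finset.range i, (y j - x j)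

/-- Partial Bender–Knuth toggle. -/
def tog (x y z : ℕ → ℤ) (i₀ : ℕ) (i : ℕ) : ℤ :=
  if i < i₀ then y i else
  if i = i₀ then max (x i) (z (i+1)) + (exc x y z i₀ + y i - 1) - y i
  else max (x i) (z (i+1)) + min (x (i-1)) (z i) - y i

theorem exc_congr {x y z x' y' z' : ℕ → ℤ} {i : ℕ} (hx : ∀ j < i, x j = x' j)
    (hy : ∀ j ≤ i, y j = y' j) (hz : ∀ j ≤ i, z j = z' j) : exc x y z i = exc x' y' z' i := by
  unfold exc
  congr 1
  · apply Finset.sum_congr rfl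
    intro j hj
    rw [Finset.mem_range] at hj
    rw [hy j (by omega), hz j (by omega)]
  · apply Finset.sum_congr rfl
    intro j hj
    rw [Finset.mem_range] at hj
    rw [hy j (by omega), hx j (by omega)]

theorem exc_succ (x y z : ℕ → ℤ) (i : ℕ) :
    exc x y z (i+1) = exc x y z i + (z (i+1) - y (i+1)) - (y i - x i) := by
  unfold exc
  rw [Finset.sum_range_succ (fun j => z j - y j) (i+1),
    Finset.sum_range_succ (fun j => y j - x j) i]
  ring

theorem exc_tog (x y z : ℕ → ℤ) (i₀ : ℕ) :
    exc x (tog x y z i₀) z i₀ = y i₀ - max (x i₀) (z (i₀+1)) + 1 := by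
  have h1 : ∀ j < i₀, tog x y z i₀ j = y j := fun j hj => by simp [tog, hj]
  have h2 : exc x (tog x y z i₀) z i₀ = exc x y z i₀ - (tog x y z i₀ i₀ - y i₀) := by
    unfold exc
    rw [Finset.sum_range_succ, Finset.sum_range_succ]
    have e1 : ∑ j ∈ Finset.range i₀, (z j - tog x y z i₀ j) = ∑ j ∈ Finset.range i₀, (z j - y j) :=
      Finset.sum_congr rfl fun j hj => by rw [h1 j (Finset.mem_range.1 hj)]
    have e2 : ∑ j ∈ Finset.range i₀, (tog x y z i₀ j - x j) = ∑ j ∈ Finset.range i₀, (y j - x j) :=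
      Finset.sum_congr rfl fun j hj => by rw [h1 j (Finset.mem_range.1 hj)]
    rw [e1, e2]
    ring
  rw [h2]
  simp [tog]
  ring

theorem tog_tog (x y z : ℕ → ℤ) (i₀ : ℕ) : tog x (tog x y z i₀) z i₀ = y := by
  ext i
  rcases lt_trichotomy i i₀ with h | rfl | h
  · simp [tog, h]
  · have := exc_tog x y z i
    rw [tog, if_neg (lt_irrefl _), if_pos rfl, this]
    ring
  · have h1 : ¬ i < i₀ := by omega
    have h2 : i ≠ i₀ := by omega
    simp [tog, h1, h2]

theorem tog_bounds {x y z : ℕ → ℤ} {i₀ : ℕ} (hxy : Strip x y) (hyz : Strip y z)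
    (hpos : 0 < exc x y z i₀) (hprev : ∀ i < i₀, exc x y z i ≤ 0) (i : ℕ) :
    max (x i) (z (i+1)) ≤ tog x y z i₀ i ∧ tog x y z i₀ i ≤ z i ∧
      (∀ j, i = j + 1 → tog x y z i₀ i ≤ x j) := by
  obtain ⟨a1, a2⟩ := hxy i
  obtain ⟨b1, b2⟩ := hyz i
  have hlo : max (x i) (z (i+1)) ≤ y i := max_le a1 b2
  rcases lt_trichotomy i i₀ with h | rfl | h
  · simp only [tog, if_pos h]
    refine ⟨hlo, b1, ?_⟩
    rintro j rfl
    exact (hxy j).2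
  · simp only [tog, lt_irrefl, if_false, if_true]
    refine ⟨by omega, ?_, ?_⟩
    · rcases i with _ | j
      · simp [exc] at *
        omega
      · have h1 := hprev j (by omega)
        have h2 := exc_succ x y z j
        have h3 := (hxy j).1
        omega
    · rintro j rfl
      have h1 := hprev j (by omega)
      have h2 := exc_succ x y z j
      have h3 := (hxy j).1
      have h4 := (hyz j).2
      omega
  · obtain ⟨j, rfl⟩ : ∃ j, i = j + 1 := ⟨i-1, by omega⟩
    have h3 := (hxy j).2
    have h1 : ¬ j + 1 < i₀ := by omega
    have h2 : j + 1 ≠ i₀ := by omega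
    simp only [tog, if_neg h1, if_neg h2, Nat.add_sub_cancel]
    refine ⟨by omega, by omega, ?_⟩
    rintro k hk
    obtain rfl : j = k := by omega
    omega

theorem tog_sum_aux (x y z : ℕ → ℤ) (i₀ : ℕ) (m : ℕ) (hm : i₀ ≤ m) :
    ∑ j ∈ Finset.range (m+1), (tog x y z i₀ j + y j - x j - z j)
      = max (x m) (z (m+1)) - x m - 1 := by
  induction m, hm using Nat.le_induction with
  | base =>
    rw [Finset.sum_range_succ]
    have e1 : ∑ j ∈ Finset.range i₀, (tog x y z i₀ j + y j - x j - z j) =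
        ∑ j ∈ Finset.range i₀, (y j - x j) - ∑ j ∈ Finset.range i₀, (z j - y j) := by
      rw [← Finset.sum_sub_distrib]
      apply Finset.sum_congr rfl
      intro j hj
      simp only [tog, if_pos (Finset.mem_range.1 hj)]
      ring
    rw [e1]
    simp only [tog, lt_irrefl, if_false, if_true, exc]
    rw [Finset.sum_range_succ]
    ring
  | succ m hm ih =>
    rw [Finset.sum_range_succ, ih]
    have h1 : ¬ m + 1 < i₀ := by omega
    have h2 : m + 1 ≠ i₀ := by omega
    simp only [tog, if_neg h1, if_neg h2, Nat.add_sub_cancel]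
    omega

/-- Excess for letters `k`, `k+1` of a chain. -/
def excC (ν : ℕ → ℕ → ℤ) (k i : ℕ) : ℤ := exc (ν k) (ν (k+1)) (ν (k+2)) i

/-- `(k, i)` is the first violation of the lattice condition. -/
def First (ν : ℕ → ℕ → ℤ) (k i : ℕ) : Prop :=
  0 < excC ν k i ∧ (∀ i' < i, ∀ k', excC ν k' i' ≤ 0) ∧ ∀ k', k < k' → excC ν k' i ≤ 0

theorem First.unique {ν : ℕ → ℕ → ℤ} {k i k' i' : ℕ} (h : First ν k i) (h' : First ν k' i') :
    k = k' ∧ i = i' := by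
  have hi : i = i' := by
    rcases lt_trichotomy i i' with hh | hh | hh
    · have h1 := h'.2.1 i hh k
      have h2 := h.1
      omega
    · exact hh
    · have h1 := h.2.1 i' hh k'
      have h2 := h'.1
      omega
  subst hi
  refine ⟨?_, rfl⟩
  rcases lt_trichotomy k k' with hh | hh | hh
  · have h1 := h.2.2 k' hh
    have h2 := h'.1
    omega
  · exact hh
  · have h1 := h'.2.2 k hh
    have h2 := h.1
    omega

theorem chain_strip {μ : ℕ → ℤ} {n N : ℕ} {α : ℕ → ℤ} {ν : ℕ → ℕ → ℤ} (hc : Chain μ n N α ν)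
    (hanti : Antitone μ) (t : ℕ) : Strip (ν t) (ν (t+1)) := by
  by_cases ht : t < N
  · exact hc.2.1 t ht
  · have h1 : ν t = ν N := hc.2.2.2 t (by omega)
    have h2 : ν (t+1) = ν N := hc.2.2.2 (t+1) (by omega)
    rw [h1, h2]
    have h3 : Antitone (ν N) := by
      rcases N with _ | N
      · rw [hc.1]; exact hanti
      · exact (hc.2.1 N (by omega)).antitone
    exact fun i => ⟨le_rfl, h3 (Nat.le_succ i)⟩

theorem chain_exc_large {μ : ℕ → ℤ} {n N : ℕ} {α : ℕ → ℤ} {ν : ℕ → ℕ → ℤ} (hc : Chain μ n N α ν)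
    (hanti : Antitone μ) (k i : ℕ) (hk : N ≤ k + 1) : excC ν k i ≤ 0 := by
  unfold excC exc
  have h1 : ν (k+1) = ν N := hc.2.2.2 (k+1) (by omega)
  have h2 : ν (k+2) = ν N := hc.2.2.2 (k+2) (by omega)
  have h3 : 0 ≤ ∑ j ∈ Finset.range i, (ν (k+1) j - ν k j) :=
    Finset.sum_nonneg fun j _ => by linarith [(chain_strip hc hanti k j).1]
  have h4 : ∑ j ∈ Finset.range (i+1), (ν (k+2) j - ν (k+1) j) = 0 :=
    Finset.sum_eq_zero fun j _ => by rw [h1, h2]; ring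
  omega

theorem exists_first {μ : ℕ → ℤ} {n N : ℕ} {α : ℕ → ℤ} {ν : ℕ → ℕ → ℤ} (hc : Chain μ n N α ν)
    (hanti : Antitone μ) (hbad : ∃ i k, 0 < excC ν k i) : ∃ k i, First ν k i := by
  classical
  obtain ⟨k₀, hk₀⟩ := Nat.find_spec hbad
  have hmin : ∀ i' < Nat.find hbad, ∀ k', excC ν k' i' ≤ 0 := by
    intro i' hi' k'
    have := Nat.find_min hbad hi'
    push Not at this
    exact this k'
  have hk₀N : k₀ ≤ N := by
    by_contra hh
    have := chain_exc_large hc hanti k₀ (Nat.find hbad) (by omega)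
    omega
  refine ⟨Nat.findGreatest (fun k => 0 < excC ν k (Nat.find hbad)) N, Nat.find hbad,
    Nat.findGreatest_spec (P := fun k => 0 < excC ν k (Nat.find hbad)) hk₀N hk₀, hmin, ?_⟩
  intro k' hk'
  by_cases hN : k' ≤ N
  · exact not_lt.1 (Nat.findGreatest_is_greatest hk' hN)
  · exact chain_exc_large hc hanti _ _ (by omega)

/-- The toggled chain. -/
def togC (ν : ℕ → ℕ → ℤ) (k i : ℕ) : ℕ → ℕ → ℤ :=
  Function.update ν (k+1) (tog (ν k) (ν (k+1)) (ν (k+2)) i)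

theorem togC_same (ν : ℕ → ℕ → ℤ) (k i : ℕ) :
    togC ν k i (k+1) = tog (ν k) (ν (k+1)) (ν (k+2)) i := by
  simp [togC]

theorem togC_ne (ν : ℕ → ℕ → ℤ) (k i t : ℕ) (ht : t ≠ k + 1) : togC ν k i t = ν t := by
  simp [togC, ht]

theorem togC_lt (ν : ℕ → ℕ → ℤ) (k i t j : ℕ) (hj : j < i) : togC ν k i t j = ν t j := by
  by_cases ht : t = k + 1
  · subst ht
    rw [togC_same]
    simp [tog, hj]
  · rw [togC_ne _ _ _ _ ht]

theorem togC_togC (ν : ℕ → ℕ → ℤ) (k i : ℕ) : togC (togC ν k i) k i = ν := by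
  ext t : 1
  by_cases ht : t = k + 1
  · subst ht
    rw [togC_same, togC_same, togC_ne _ _ _ k (by omega), togC_ne _ _ _ (k+2) (by omega), tog_tog]
  · rw [togC_ne _ _ _ _ ht, togC_ne _ _ _ _ ht]

theorem togC_first {μ : ℕ → ℤ} {n N : ℕ} {α : ℕ → ℤ} {ν : ℕ → ℕ → ℤ} (hc : Chain μ n N α ν)
    (hanti : Antitone μ) {k i : ℕ} (hF : First ν k i) : First (togC ν k i) k i := by
  refine ⟨?_, ?_, ?_⟩
  · unfold excC
    rw [togC_same, togC_ne _ _ _ k (by omega), togC_ne _ _ _ (k+2) (by omega), exc_tog]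
    have h1 := (chain_strip hc hanti k i).1
    have h2 := (chain_strip hc hanti (k+1) i).2
    have h3 : ν (k+1+1) (i+1) = ν (k+2) (i+1) := rfl
    omega
  · intro i' hi' k'
    have : excC (togC ν k i) k' i' = excC ν k' i' := by
      apply exc_congr
      · intro j hj; exact togC_lt _ _ _ _ _ (by omega)
      · intro j hj; exact togC_lt _ _ _ _ _ (by omega)
      · intro j hj; exact togC_lt _ _ _ _ _ (by omega)
    rw [this]
    exact hF.2.1 i' hi' k'
  · intro k' hk'
    have : excC (togC ν k i) k' i = excC ν k' i := by
      apply exc_congr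
      · intro j hj; exact togC_lt _ _ _ _ _ (by omega)
      · intro j hj; rw [togC_ne _ _ _ _ (by omega)]
      · intro j hj; rw [togC_ne _ _ _ _ (by omega)]
    rw [this]
    exact hF.2.2 k' hk'

theorem first_lt {μ : ℕ → ℤ} {n N : ℕ} {α : ℕ → ℤ} {ν : ℕ → ℕ → ℤ} (hc : Chain μ n N α ν)
    (hanti : Antitone μ) {k i : ℕ} (hF : First ν k i) : k + 1 < N := by
  by_contra hh
  have := chain_exc_large hc hanti k i (by omega)
  have := hF.1
  omega

theorem togC_chain {μ : ℕ → ℤ} {n N : ℕ} {α : ℕ → ℤ} {ν : ℕ → ℕ → ℤ} (hc : Chain μ n N α ν)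
    (hanti : Antitone μ) {L : ℕ} (hL : ∀ i, L ≤ i → μ i = 0) (hn : L + N ≤ n)
    {k i : ℕ} (hF : First ν k i) (α' : ℕ → ℤ)
    (ha1 : α' k = α (k+1) - 1) (ha2 : α' (k+1) = α k + 1)
    (ha3 : ∀ t < N, t ≠ k → t ≠ k + 1 → α' t = α t) : Chain μ n N α' (togC ν k i) := by
  have hkN := first_lt hc hanti hF
  have sxy := chain_strip hc hanti k
  have syz := chain_strip hc hanti (k+1)
  have hb := tog_bounds sxy syz hF.1 (fun i' hi' => hF.2.1 i' hi' k)
  have hx := chain_facts hc hanti L hL k (by omega)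
  have hy := chain_facts hc hanti L hL (k+1) (by omega)
  have hz := chain_facts hc hanti L hL (k+2) (by omega)
  have hin : i < n := by
    by_contra hh
    obtain ⟨j, rfl⟩ : ∃ j, i = j + 1 := ⟨i-1, by omega⟩
    have h1 := hF.1
    have h2 := hF.2.1 j (by omega) k
    unfold excC at h1 h2
    rw [exc_succ, hy.2 (j+1) (by omega), hz.2 (j+1) (by omega)] at h1
    have h3 := (sxy j).1
    omega
  have hsum : ∑ j ∈ Finset.range n,
      (tog (ν k) (ν (k+1)) (ν (k+2)) i j + ν (k+1) j - ν k j - ν (k+2) j) = - 1 := by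
    obtain ⟨m, rfl⟩ : ∃ m, n = m + 1 := ⟨n-1, by omega⟩
    rw [tog_sum_aux _ _ _ _ _ (by omega), hz.2 (m+1) (by omega)]
    have : 0 ≤ ν k m := by
      have h1 := hx.1 (Nat.le_add_right m (L+k))
      rw [hx.2 (m + (L+k)) (by omega)] at h1
      exact h1
    omega
  have hs1 := hc.2.2.1 k (by omega)
  have hs2 := hc.2.2.1 (k+1) (by omega)
  simp only [Finset.sum_sub_distrib, Finset.sum_add_distrib] at hsum hs1 hs2
  refine ⟨?_, ?_, ?_, ?_⟩
  · rw [togC_ne _ _ _ _ (by omega)]; exact hc.1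
  · intro t ht
    by_cases h1 : t = k
    · subst h1
      rw [togC_same, togC_ne _ _ _ _ (by omega)]
      exact fun j => ⟨(le_max_left _ _).trans (hb j).1, (hb (j+1)).2.2 j rfl⟩
    by_cases h2 : t = k + 1
    · subst h2
      rw [togC_same, togC_ne _ _ _ _ (by omega)]
      exact fun j => ⟨(hb j).2.1, (le_max_right _ _).trans (hb j).1⟩
    rw [togC_ne _ _ _ _ h2, togC_ne _ _ _ _ (by omega)]
    exact hc.2.1 t ht
  · intro t ht
    by_cases h1 : t = k
    · subst h1
      rw [togC_same, togC_ne _ _ _ _ (by omega), Finset.sum_sub_distrib]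
      have e : ν (t+1+1) = ν (t+2) := rfl
      rw [e] at hs2
      linarith
    by_cases h2 : t = k + 1
    · subst h2
      rw [togC_same, togC_ne _ _ _ _ (by omega), Finset.sum_sub_distrib]
      have e : ν (k+1+1) = ν (k+2) := rfl
      rw [e] at hs2 ⊢
      linarith
    rw [togC_ne _ _ _ _ h2, togC_ne _ _ _ _ (by omega), ha3 t ht h1 h2]
    exact hc.2.2.1 t ht
  · intro t ht
    rw [togC_ne _ _ _ _ (by omega), togC_ne _ _ _ _ (by omega)]
    exact hc.2.2.2 t ht

theorem good_content {μ : ℕ → ℤ} {n N : ℕ} {α : ℕ → ℤ} {ν : ℕ → ℕ → ℤ} (hc : Chain μ n N α ν)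
    (hanti : Antitone μ) {L : ℕ} (hL : ∀ i, L ≤ i → μ i = 0) (hn : L + N ≤ n)
    (hgood : ∀ k i, excC ν k i ≤ 0) (k : ℕ) (hk : k + 1 < N) : α (k+1) ≤ α k := by
  have hs1 := hc.2.2.1 k (by omega)
  have hs2 := hc.2.2.1 (k+1) (by omega)
  have h := hgood k n
  have hy := chain_facts hc hanti L hL (k+1) (by omega)
  have hz := chain_facts hc hanti L hL (k+2) (by omega)
  unfold excC exc at h
  rw [Finset.sum_range_succ, hy.2 n (by omega), hz.2 n (by omega)] at h
  have e : ν (k+1+1) = ν (k+2) := rfl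
  rw [e] at hs2
  omega

/-! ### Assembling -/

/-- Content attached to a permutation in the Jacobi–Trudi expansion. -/
def contentW (lam : ℕ → ℤ) (N : ℕ) (w : Equiv.Perm (Fin N)) (t : ℕ) : ℤ :=
  if ht : t < N then lam (w ⟨t, ht⟩) - ((w ⟨t, ht⟩ : Fin N) : ℕ) + t else 0

/-- Adjacent transposition. -/
def adjSwap (N k : ℕ) : Equiv.Perm (Fin N) :=
  if hk : k + 1 < N then Equiv.swap ⟨k, by omega⟩ ⟨k+1, hk⟩ else 1

theorem perm_eq_one_of_strictMono {N : ℕ} (w : Equiv.Perm (Fin N)) (hw : StrictMono w) : w = 1 := by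
  have : (StrictMono.orderIsoOfSurjective w hw w.surjective) = OrderIso.refl _ :=
    Subsingleton.elim _ _
  ext i
  have h := congrArg (fun e : Fin N ≃o Fin N => e i) this
  simpa using congrArg Fin.val h

open Classical in
/-- The involution. -/
noncomputable def invol (N : ℕ) (p : (_ : Equiv.Perm (Fin N)) × (ℕ → ℕ → ℤ)) :
    (_ : Equiv.Perm (Fin N)) × (ℕ → ℕ → ℤ) :=
  if hp : ∃ q : ℕ × ℕ, First p.2 q.1 q.2 then
    ⟨p.1 * adjSwap N hp.choose.1, togC p.2 hp.choose.1 hp.choose.2⟩ else p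

theorem invol_eq (N : ℕ) (p : (_ : Equiv.Perm (Fin N)) × (ℕ → ℕ → ℤ)) (k i : ℕ)
    (hF : First p.2 k i) : invol N p = ⟨p.1 * adjSwap N k, togC p.2 k i⟩ := by
  have hp : ∃ q : ℕ × ℕ, First p.2 q.1 q.2 := ⟨(k, i), hF⟩
  obtain ⟨h1, h2⟩ := First.unique hp.choose_spec hF
  rw [invol, dif_pos hp, h1, h2]

theorem adjSwap_mul_self (N k : ℕ) : adjSwap N k * adjSwap N k = 1 := by
  unfold adjSwap
  split_ifs <;> simp

theorem invol_invol (N : ℕ) (p : (_ : Equiv.Perm (Fin N)) × (ℕ → ℕ → ℤ)) (k i : ℕ)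
    (hF : First p.2 k i) (hF' : First (togC p.2 k i) k i) : invol N (invol N p) = p := by
  obtain ⟨w, ν⟩ := p
  have e1 := invol_eq N ⟨w, ν⟩ k i hF
  have e2 := invol_eq N ⟨w * adjSwap N k, togC ν k i⟩ k i hF'
  rw [e1, e2]
  simp only [togC_togC, mul_assoc, adjSwap_mul_self, mul_one]

theorem lr_generic (lam μ : ℕ → ℤ) (N L n : ℕ) (hlam : Antitone lam) (hanti : Antitone μ)
    (hL : ∀ i, L ≤ i → μ i = 0) (hn : L + N ≤ n) :
    ∃ D : Finset ((_ : Equiv.Perm (Fin N)) × (ℕ → ℕ → ℤ)),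
      (∀ p ∈ D, Chain μ n N (contentW lam N p.1) p.2) ∧
      ∀ (R : Type) [CommRing R] (h : ℤ → R), h 0 = 1 → (∀ d < 0, h d = 0) →
        Sd h N lam * Sd h n μ = ∑ p ∈ D, Sd h n (p.2 N) := by
  classical
  have key := fun w : Equiv.Perm (Fin N) => chain_sum μ hanti L hL n (contentW lam N w) N hn
  choose C hC hsum using key
  let E := Finset.univ.sigma C
  have hE : ∀ p, p ∈ E ↔ Chain μ n N (contentW lam N p.1) p.2 := by
    intro p
    simp only [E, Finset.mem_sigma, Finset.mem_univ, true_and, hC]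
  let good : ((_ : Equiv.Perm (Fin N)) × (ℕ → ℕ → ℤ)) → Prop := fun p => ∀ k i, excC p.2 k i ≤ 0
  refine ⟨E.filter good, fun p hp => (hE p).1 (Finset.mem_filter.1 hp).1, ?_⟩
  intro R _ h h0 hneg
  have e1 : Sd h N lam * Sd h n μ
      = ∑ p ∈ E, (Equiv.Perm.sign p.1 : ℤ) • Sd h n (p.2 N) := by
    rw [Finset.sum_sigma]
    conv_lhs => rw [Sd, Matrix.det_apply, Finset.sum_mul]
    apply Finset.sum_congr rfl
    intro w _
    dsimp only
    rw [← Finset.smul_sum, ← hsum w R h h0 hneg, Units.smul_def, smul_mul_assoc, mul_comm,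
      Finset.prod_range]
    congr 2
    apply Finset.prod_congr rfl
    intro t _
    simp [contentW]
  rw [e1, ← Finset.sum_filter_add_sum_filter_not E good]
  have e2 : ∑ p ∈ E.filter (fun p => ¬ good p), (Equiv.Perm.sign p.1 : ℤ) • Sd h n (p.2 N) = 0 := by
    have hbad : ∀ p ∈ E.filter (fun p => ¬ good p),
        Chain μ n N (contentW lam N p.1) p.2 ∧ ∃ k i, First p.2 k i := by
      intro p hp
      rw [Finset.mem_filter] at hp
      have hc := (hE p).1 hp.1
      refine ⟨hc, exists_first hc hanti ?_⟩
      have := hp.2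
      simp only [good] at this
      push Not at this
      obtain ⟨k, i, hki⟩ := this
      exact ⟨i, k, hki⟩
    have hsgn : ∀ p ∈ E.filter (fun p => ¬ good p),
        (Equiv.Perm.sign (invol N p).1 : ℤ) = - (Equiv.Perm.sign p.1 : ℤ) := by
      intro p hp
      obtain ⟨hc, k, i, hF⟩ := hbad p hp
      have hk := first_lt hc hanti hF
      rw [invol_eq N p k i hF]
      simp only [adjSwap, dif_pos hk, Equiv.Perm.sign_mul]
      rw [Equiv.Perm.sign_swap (by simp)]
      simp
    refine Finset.sum_involution (fun p _ => invol N p) ?_ ?_ ?_ ?_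
    · intro p hp
      rw [hsgn p hp]
      obtain ⟨hc, k, i, hF⟩ := hbad p hp
      have hk := first_lt hc hanti hF
      rw [invol_eq N p k i hF]
      dsimp only
      rw [togC_ne _ _ _ N (by omega), neg_smul, add_neg_cancel]
    · intro p hp _ heq
      have h1 := hsgn p hp
      rw [heq] at h1
      have h2 : (Equiv.Perm.sign p.1 : ℤ) ≠ 0 := Units.ne_zero _
      omega
    · intro p hp
      obtain ⟨hc, k, i, hF⟩ := hbad p hp
      have hk := first_lt hc hanti hF
      rw [invol_eq N p k i hF, Finset.mem_filter, hE]
      refine ⟨?_, ?_⟩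
      · apply togC_chain hc hanti hL hn hF
        · simp only [contentW, adjSwap, dif_pos hk, dif_pos (show k < N by omega),
            Equiv.Perm.mul_apply, Equiv.swap_apply_left]
          push_cast; ring
        · simp only [contentW, adjSwap, dif_pos hk, dif_pos (show k < N by omega),
            Equiv.Perm.mul_apply, Equiv.swap_apply_right]
          push_cast; ring
        · intro t ht h1 h2
          simp only [contentW, adjSwap, dif_pos hk, dif_pos ht, Equiv.Perm.mul_apply]
          rw [Equiv.swap_apply_of_ne_of_ne]
          · simpa using h1
          · simpa using h2
      · intro hg
        have h1 := hg k i
        have h2 := (togC_first hc hanti hF).1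
        dsimp only at h1
        omega
    · intro p hp
      obtain ⟨hc, k, i, hF⟩ := hbad p hp
      exact invol_invol N p k i hF (togC_first hc hanti hF)
  rw [e2, add_zero]
  apply Finset.sum_congr rfl
  intro p hp
  rw [Finset.mem_filter] at hp
  have hc := (hE p).1 hp.1
  have hw : p.1 = 1 := by
    apply perm_eq_one_of_strictMono
    rcases N with _ | N
    · intro a; exact a.elim0
    · rw [Fin.strictMono_iff_lt_succ]
      intro k
      have hk := k.2
      have h1 := good_content hc hanti hL hn hp.2 k (by omega)
      simp only [contentW, dif_pos (show (k : ℕ) < N + 1 by omega),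
        dif_pos (show (k : ℕ) + 1 < N + 1 by omega)] at h1
      have e1 : (⟨(k : ℕ), by omega⟩ : Fin (N+1)) = k.castSucc := rfl
      have e2 : (⟨(k : ℕ) + 1, by omega⟩ : Fin (N+1)) = k.succ := rfl
      rw [e1, e2] at h1
      by_contra hh
      rw [not_lt] at hh
      have h3 : ((p.1 k.succ : Fin (N+1)) : ℕ) ≤ ((p.1 k.castSucc : Fin (N+1)) : ℕ) := hh
      have h4 := hlam h3
      push_cast at h1
      omega
  rw [hw]
  simp

/-- Parts as integers. -/
def Partition'.zparts (P : Partition') (i : ℕ) : ℤ := P.parts i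

theorem Partition'.zparts_antitone (P : Partition') : Antitone P.zparts := fun i j hij => by
  unfold Partition'.zparts
  exact_mod_cast P.antitone hij

theorem Partition'.zparts_zero (P : Partition') (i : ℕ) (hi : P.length ≤ i) : P.zparts i = 0 := by
  have h1 : P.parts P.length = 0 := Nat.sInf_mem (s := {n | P.parts n = 0}) P.eventually_zero
  have h2 := P.antitone hi
  unfold Partition'.zparts
  omega

theorem hpoly_zero (m : ℕ) : hpoly m 0 = 1 := by simp [hpoly]

theorem hpoly_neg (m : ℕ) (d : ℤ) (hd : d < 0) : hpoly m d = 0 := by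
  simp [hpoly, hd]

theorem schur_eq (m : ℕ) (P : Partition') (n : ℕ) (hn : P.length ≤ n) :
    schur m P = Sd (hpoly m) n P.zparts := by
  rw [Sd_stable (hpoly m) (hpoly_zero m) (hpoly_neg m) P.length n hn P.zparts P.zparts_zero]
  rfl

theorem lr_partition (lam mu : Partition') :
    ∃ c : Partition' → ℕ, (Function.support c).Finite ∧
      (∀ ν : Partition', lam.length + mu.length < ν.length → c ν = 0) ∧
      ∀ r, schur r lam * schur r mu = ∑ᶠ ν : Partition', (c ν : ℤ) • schur r ν := by
  classical
  set n := mu.length + lam.length with hn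
  obtain ⟨D, hD, hsum⟩ := lr_generic lam.zparts mu.zparts lam.length mu.length n
    lam.zparts_antitone mu.zparts_antitone mu.zparts_zero le_rfl
  have key : ∀ p : (_ : Equiv.Perm (Fin lam.length)) × (ℕ → ℕ → ℤ), ∃ P : Partition',
      p ∈ D → P.zparts = p.2 lam.length ∧ P.length ≤ n := by
    intro p
    by_cases hp : p ∈ D
    · obtain ⟨h1, h2⟩ := chain_facts (hD p hp) mu.zparts_antitone mu.length mu.zparts_zero
        lam.length le_rfl
      have hpos : ∀ i, 0 ≤ p.2 lam.length i := by
        intro i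
        have h3 := h1 (Nat.le_add_right i n)
        rw [h2 _ (by omega)] at h3
        exact h3
      refine ⟨⟨fun i => (p.2 lam.length i).toNat, ?_, n, ?_⟩, fun _ => ⟨?_, ?_⟩⟩
      · intro i j hij
        exact Int.toNat_le_toNat (h1 hij)
      · simp [h2 n le_rfl]
      · ext i
        simp [Partition'.zparts, hpos i]
      · apply Nat.sInf_le
        simp [h2 n le_rfl]
    · exact ⟨mu, fun h => absurd h hp⟩
  choose P hP using key
  have hsupp : ∀ ν, (D.filter (fun p => P p = ν)).card ≠ 0 → ν ∈ D.image P := by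
    intro ν hν
    obtain ⟨p, hp⟩ := Finset.card_ne_zero.1 hν
    rw [Finset.mem_filter] at hp
    exact Finset.mem_image.2 ⟨p, hp⟩
  refine ⟨fun ν => (D.filter (fun p => P p = ν)).card, ?_, ?_, ?_⟩
  · exact (D.image P).finite_toSet.subset fun ν hν => hsupp ν hν
  · intro ν hν
    by_contra hh
    obtain ⟨p, hp, rfl⟩ := Finset.mem_image.1 (hsupp ν hh)
    have := (hP p hp).2
    omega
  · intro r
    rw [finsum_eq_sum_of_support_subset (s := D.image P), schur_eq r lam _ le_rfl,
      schur_eq r mu n (by omega), hsum _ (hpoly r) (hpoly_zero r) (hpoly_neg r)]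
    · have h1 := Finset.sum_comp (s := D) (fun ν => schur r ν) P
      simp only [natCast_zsmul]
      rw [← h1]
      apply Finset.sum_congr rfl
      intro p hp
      rw [schur_eq r (P p) n (hP p hp).2, (hP p hp).1]
    · intro ν hν
      apply hsupp
      intro h0
      apply hν
      simp [h0]

/-- **Stability of the tensor product decomposition for general linear groups,
in character form.** Let `λ` and `μ` be partitions and `r ≥ l(λ) + l(μ)`. Then
there is a finitely supported family of natural numbers `c_ν`, indexed by
partitions `ν`, with `c_ν = 0` whenever `l(ν) > l(λ) + l(μ)`, such that
simultaneously `S_λ^{(r)} · S_μ^{(r)} = Σ_ν c_ν S_ν^{(r)}` in `ℤ[X_1,…,X_r]`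
and `S_λ^{(r+1)} · S_μ^{(r+1)} = Σ_ν c_ν S_ν^{(r+1)}` in `ℤ[X_1,…,X_{r+1}]`. -/
theorem schur_mul_stable (lam mu : Partition') (r : ℕ)
    (hr : lam.length + mu.length ≤ r) :
    ∃ c : Partition' → ℕ, (Function.support c).Finite ∧
      (∀ ν : Partition', lam.length + mu.length < ν.length → c ν = 0) ∧
      schur r lam * schur r mu = ∑ᶠ ν : Partition', (c ν : ℤ) • schur r ν ∧
      schur (r + 1) lam * schur (r + 1) mu =
        ∑ᶠ ν : Partition', (c ν : ℤ) • schur (r + 1) ν := by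
  obtain ⟨c, h1, h2, h3⟩ := lr_partition lam mu
  exact ⟨c, h1, h2, h3 r, h3 (r + 1)⟩
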